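/- Let a ∈ P_m, b ∈ P_n, Θ ∈ R(a,b), and let a', b' be subwords of a, b with F_{a'} ⊆ F_a and F_{b'} ⊆ F_b, of lengths m' and n' respectively. Let Θ_m be the restriction of Θ to F_{a'} and F_{b'} + m, and let a'Θ_m b' be the word whose LR-decomposition is obtained from F_{a'} and F_{b'} + m by concatenating u·(w+m) for each edge (u, w+m) of Θ_m and keeping all unmatched words. Let Θ' be the matching between F_{Park(a')} and F_{Park(b')} + m' with edge set {(u, w+m') : ι_1(u)·(ι_2(w)+m) ∈ F_{a'Θ_m b'}}, where ι_1: F_{Park(a')} → F_{a'} and ι_2: F_{Park(b')} → F_{b'} are the canonical bijections. Then Park(a'Θ_m b') = Park(a') Θ' Park(b'), where Park(a') Θ' Park(b') denotes the parking function whose LR-decomposition is obtained from F_{Park(a')} and F_{Park(b')} + m' by concatenating matched pairs and keeping unmatched words. -/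

import Mathlib

open scoped Classical

/-- Words on natural numbers (letters are intended to be positive integers). -/
abbrev W : Type := List ℕ

/-- `IsPF a` : the word `a` is a parking function, i.e. all its letters are
positive and its nondecreasing rearrangement `b₁ b₂ ⋯ bₙ` satisfies `bᵢ ≤ i`. -/
def IsPF (a : W) : Prop :=
  (∀ x ∈ a, 1 ≤ x) ∧
    ∀ i, i < a.length → (a.insertionSort (· ≤ ·)).getD i 0 ≤ i + 1

/-- Split a word into the consecutive segments beginning at its
left-to-right minima (in the order in which they occur in the word). -/
def segs : W → List W
  | [] => []
  | x :: xs =>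
      (x :: xs.takeWhile fun y => x ≤ y) :: segs (xs.dropWhile fun y => x ≤ y)
termination_by a => a.length
decreasing_by
  simpa using Nat.lt_succ_of_le (List.dropWhile_sublist _).length_le

/-- The LR-decomposition `F_a` of a word `a`: the sequence of segments beginning
at the left-to-right minima, listed in increasing order of their minimal letters
(i.e. in reverse order of occurrence in `a`). -/
def LR (a : W) : List W := (segs a).reverse

/-- The word `w_k ⋯ w_2 w_1` encoded by an LR-decomposition `(w_1, …, w_k)`. -/
def wordOf (F : List W) : W := F.reverse.flatten

/-- A word is dominated if it is nonempty and its first letter is its minimal letter. -/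
def Dominated (w : W) : Prop := w ≠ [] ∧ ∀ x ∈ w, w.headD 0 ≤ x

/-- The minimal letter of a word (`0` for the empty word). -/
def minW (w : W) : ℕ := (w.min?).getD 0

/-- Add `m` to every letter of a word. -/
def shiftW (m : ℕ) (w : W) : W := w.map (· + m)

/-- Add `m` to every letter of every word of a sequence of words. -/
def shiftF (m : ℕ) (F : List W) : List W := F.map (shiftW m)

/-- The word whose LR-decomposition is the finite set of words `G`:
sort `G` increasingly (for dominated words with distinct minimal letters the
lexicographic order agrees with comparing the minimal letters) and concatenate
in decreasing order. -/
noncomputable def wordOfSet (G : Finset W) : W := (G.sort (· ≤ ·)).reverse.flatten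

/-- Given vertex sets `X`, `Y` (of words) and a set `Θ` of edges, the resulting
set of words: concatenations `u ++ w` over edges `(u, w) ∈ Θ`, together with all
unmatched words of `X` and of `Y`. -/
noncomputable def glueSet (X Y : Finset W) (Θ : Finset (W × W)) : Finset W :=
  Θ.image (fun p => p.1 ++ p.2) ∪
    X.filter (fun u => ∀ p ∈ Θ, p.1 ≠ u) ∪
    Y.filter (fun w => ∀ p ∈ Θ, p.2 ≠ w)

/-- `R(a,b)` : the set of matchings between `F_a` and `F_b + m` (`m` the length
of `a`), encoded as sets of edges in which no vertex occurs twice. -/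
noncomputable def Rset (a b : W) : Finset (Finset (W × W)) :=
  ((LR a).toFinset ×ˢ (shiftF a.length (LR b)).toFinset).powerset.filter
    (fun Θ => ∀ p ∈ Θ, ∀ q ∈ Θ, (p.1 = q.1 ∨ p.2 = q.2) → p = q)

/-- `aΘb` : the parking function whose LR-decomposition consists of the
concatenations `u ⬝ (w + m)` over the edges `(u, w + m)` of `Θ` together with all
unmatched words of `F_a` and of `F_b + m`. -/
noncomputable def mTheta (a b : W) (Θ : Finset (W × W)) : W :=
  wordOfSet (glueSet (LR a).toFinset (shiftF a.length (LR b)).toFinset Θ)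

/-- `d(a) = min { i : #{ j : a_j ≤ i } < i }`. -/
def dVal (a : W) : ℕ :=
  Nat.find (p := fun i => (a.filter (fun x => x ≤ i)).length < i)
    ⟨a.length + 1, Nat.lt_succ_of_le (List.length_filter_le _ _)⟩

/-- One step of the parkization algorithm: decrement every letter greater
than `d(a)`.  (This is the identity when `a` is a parking function.) -/
def parkStep (a : W) : W := a.map fun x => if dVal a < x then x - 1 else x

/-- Auxiliary fueled version of the parkization algorithm. -/
def parkFuel : ℕ → W → W
  | 0, a => a
  | k + 1, a => if dVal a = a.length + 1 then a else parkFuel k (parkStep a)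

/-- The parkization `Park a` of a word `a`.  (For a word with positive letters
the algorithm needs at most `a.sum` steps, so the fuel below suffices.) -/
def Park (a : W) : W := parkFuel a.sum a

/-- The subword of `a` obtained by keeping exactly the words of `F_a`
belonging to `S`. -/
def subWord (a : W) (S : Finset W) : W := wordOf ((LR a).filter (· ∈ S))

/-- The free module with basis indexed by words; the Hopf algebra `PFSym` is
its submodule spanned by `{M_a : a ∈ P}`. -/
abbrev FW (K : Type) [Field K] : Type := W →₀ K

/-- The monomial basis element `M_a`. -/
noncomputable def Mb (K : Type) [Field K] (a : W) : FW K := Finsupp.single a 1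

/-- `M_a ⋆ M_b = Σ_{Θ ∈ R(a,b)} M_{aΘb}` on basis elements. -/
noncomputable def mulSingle (K : Type) [Field K] (a b : W) : FW K :=
  ∑ Θ ∈ Rset a b, Mb K (mTheta a b Θ)

/-- The product `⋆`, extended bilinearly. -/
noncomputable def starF (K : Type) [Field K] (x y : FW K) : FW K :=
  x.sum fun a ca => y.sum fun b cb => (ca * cb) • mulSingle K a b

/-- The free module with basis indexed by pairs of words; it realizes the
tensor square of `FW K` via `M_a ⊗ M_b ↦ single (a,b)`. -/
abbrev FW2 (K : Type) [Field K] : Type := (W × W) →₀ K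

/-- `Δ(M_a) = Σ M_{Park a'} ⊗ M_{Park a''}` over ordered pairs `(a', a'')` of
subwords of `a` with `F_{a'} ⊍ F_{a''} = F_a` (encoded by the subset
`S ⊆ F_a` of words kept in `a'`). -/
noncomputable def deltaSingle (K : Type) [Field K] (a : W) : FW2 K :=
  ∑ S ∈ ((LR a).toFinset).powerset,
    Finsupp.single
      (Park (subWord a S), Park (subWord a (((LR a).toFinset) \ S))) 1

/-- The coproduct `Δ`, extended linearly. -/
noncomputable def deltaF (K : Type) [Field K] (x : FW K) : FW2 K :=
  x.sum fun a ca => ca • deltaSingle K a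

/-- The componentwise product on the tensor square, on basis elements:
`(M_a ⊗ M_b) ⋆ (M_c ⊗ M_d) = (M_a ⋆ M_c) ⊗ (M_b ⋆ M_d)`. -/
noncomputable def star2Single (K : Type) [Field K] (p q : W × W) : FW2 K :=
  ∑ Θ ∈ Rset p.1 q.1, ∑ Θ' ∈ Rset p.2 q.2,
    Finsupp.single (mTheta p.1 q.1 Θ, mTheta p.2 q.2 Θ') 1

/-- The componentwise product on the tensor square, extended bilinearly. -/
noncomputable def star2F (K : Type) [Field K] (x y : FW2 K) : FW2 K :=
  x.sum fun p cp => y.sum fun q cq => (cp * cq) • star2Single K p q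

/-- The counit `ε` on basis elements. -/
noncomputable def epsW (K : Type) [Field K] (a : W) : K := if a = [] then 1 else 0

/-- `F_a ∘ F_b` : concatenate the `i`-th words of `F_a` and `F_b + m`
for `i ≤ min(r,s)` and keep the remaining unpaired words. -/
def splitLR (F G : List W) : List W :=
  List.zipWith (· ++ ·) F G ++ F.drop G.length ++ G.drop F.length

/-- The split product `a ∘ b`. -/
def splitProd (a b : W) : W := wordOf (splitLR (LR a) (shiftF a.length (LR b)))

/-- A nonempty parking function is unsplitable if it is not the split product
of two nonempty parking functions. -/
def UnsplitablePF (a : W) : Prop :=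
  IsPF a ∧ a ≠ [] ∧
    ¬ ∃ b c : W, IsPF b ∧ IsPF c ∧ b ≠ [] ∧ c ≠ [] ∧ a = splitProd b c

/-- The slash product `a | b = (b₁+m) ⋯ (bₙ+m) a₁ ⋯ a_m`. -/
def slashProd (a b : W) : W := shiftW a.length b ++ a

/-- A nonempty parking function is atomic if it is not the slash product
of two nonempty parking functions. -/
def AtomicPF (a : W) : Prop :=
  IsPF a ∧ a ≠ [] ∧
    ¬ ∃ b c : W, IsPF b ∧ IsPF c ∧ b ≠ [] ∧ c ≠ [] ∧ a = slashProd b c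

/-- `u ≺* v` : either `v` is a proper initial subword of `u`, or `u` is not a
proper initial subword of `v` and `u` precedes `v` lexicographically. -/
def precStar (u v : W) : Prop :=
  (v <+: u ∧ v ≠ u) ∨ (¬ (u <+: v ∧ u ≠ v) ∧ List.Lex (· < ·) u v)

/-- `a ≺*_lex b` : `F_a` strictly precedes `F_b` in the lexicographic order
on sequences of words induced by `≺*`. -/
def precStarLex (a b : W) : Prop := List.Lex precStar (LR a) (LR b)

/-- The covering relation of `≤_*` : `b` covers `a` if `F_b` is obtained from
`F_a = (w_1, …, w_r)` by replacing `w_i` by `w_i ⬝ w_j` and removing `w_j`,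
for some `i < j` such that every letter of `w_i` is at most every letter of `w_j`. -/
def CovStar (a b : W) : Prop :=
  ∃ i j, i < j ∧ j < (LR a).length ∧
    (∀ x ∈ (LR a).getD i [], ∀ y ∈ (LR a).getD j [], x ≤ y) ∧
    LR b = ((LR a).set i ((LR a).getD i [] ++ (LR a).getD j [])).eraseIdx j

/-- The partial order `≤_*` on parking functions, generated by the covering
relations. -/
def leStar (a b : W) : Prop := Relation.ReflTransGen CovStar a b

/-- The finite set of all parking functions of length `n`. -/
noncomputable def pfFinset (n : ℕ) : Finset W :=
  ((Finset.univ : Finset (Fin n → Fin n)).image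
      (fun f => List.ofFn fun i => (f i).val + 1)).filter IsPF

/-- The basis element `Q_a = Σ_{a ≤_* b} M_b`. -/
noncomputable def Qb (K : Type) [Field K] (a : W) : FW K :=
  ∑ b ∈ (pfFinset a.length).filter (fun b => leStar a b), Mb K b

/-- `Q_x ⊗ Q_y` as an element of the tensor square. -/
noncomputable def QT (K : Type) [Field K] (x y : W) : FW2 K :=
  ∑ b ∈ (pfFinset x.length).filter (fun b => leStar x b),
    ∑ c ∈ (pfFinset y.length).filter (fun c => leStar y c),
      Finsupp.single (b, c) 1

/-- `a` is a nonincreasing word. -/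
def NonInc (a : W) : Prop := a.Chain' (fun x y => y ≤ x)

/-- Every word of the LR-decomposition of `a` is nondecreasing. -/
def Nprop (a : W) : Prop := ∀ w ∈ LR a, w.Chain' (· ≤ ·)

/-- The words of the LR-decomposition of `a` have pairwise disjoint sets of letters. -/
def Dprop (a : W) : Prop := (LR a).Pairwise (fun u v => ∀ x ∈ u, x ∉ v)

/-- `a` is a permutation of `{1, …, n}` viewed as a word. -/
def Sprop (a : W) : Prop := a.Perm (List.range' 1 a.length)


/-- The restriction `Θ_m` of a matching `Θ` to the vertex sets
`F_{a'}` and `F_{b'} + m` (with `m` the length of `a`). -/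
noncomputable def restrictTheta (a a' b' : W) (Θ : Finset (W × W)) : Finset (W × W) :=
  Θ.filter (fun p => p.1 ∈ (LR a').toFinset ∧ p.2 ∈ (shiftF a.length (LR b')).toFinset)

/-- The word `a' Θ_m b'` obtained from `F_{a'}` and `F_{b'} + m` by concatenating
the pairs matched by `Θ_m` and keeping the unmatched words. -/
noncomputable def glueSub (a a' b' : W) (Θ : Finset (W × W)) : W :=
  wordOfSet (glueSet (LR a').toFinset (shiftF a.length (LR b')).toFinset
    (restrictTheta a a' b' Θ))

/-- The matching `Θ'` between `F_{Park a'}` and `F_{Park b'} + m'` (`m'` the length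
of `a'`) whose edges are the pairs `(u, w + m')` such that `ι₁(u)⬝(ι₂(w) + m)` is a
word of `F_{a'Θ_m b'}`, where the canonical bijections `ι₁ : F_{Park a'} → F_{a'}`
and `ι₂ : F_{Park b'} → F_{b'}` match up the words of the same index. -/
noncomputable def thetaPrime (a a' b' : W) (Θ : Finset (W × W)) : Finset (W × W) :=
  ((Finset.range (LR a').length ×ˢ Finset.range (LR b').length).filter
      (fun ij => ((LR a').getD ij.1 [] ++ shiftW a.length ((LR b').getD ij.2 [])) ∈
        glueSet (LR a').toFinset (shiftF a.length (LR b')).toFinset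
          (restrictTheta a a' b' Θ))).image
    (fun ij => ((LR (Park a')).getD ij.1 [], shiftW a'.length ((LR (Park b')).getD ij.2 [])))

/-- number of letters at most `k`. -/
def cntLe (a : W) (k : ℕ) : ℕ := (a.filter (fun x => x ≤ k)).length

/-- explicit parkization map on letters. -/
def pkf (a : W) : ℕ → ℕ
  | 0 => 0
  | x + 1 => min (pkf a x) (cntLe a x) + 1

lemma cntLe_mono (a : W) {k l : ℕ} (h : k ≤ l) : cntLe a k ≤ cntLe a l := by
  unfold cntLe
  rw [← List.countP_eq_length_filter, ← List.countP_eq_length_filter]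
  apply List.countP_mono_left
  intro x _ hx
  simp at hx ⊢
  omega

lemma pkf_eq_self (a : W) (d : ℕ) (h : ∀ i < d, i ≤ cntLe a i) : ∀ x ≤ d, pkf a x = x := by
  intro x
  induction x with
  | zero => intro _; rfl
  | succ x ih =>
    intro hx
    have := ih (by omega)
    have := h x (by omega)
    simp only [pkf]
    omega

lemma pkf_le_cnt (a : W) (x : ℕ) : pkf a (x+1) ≤ cntLe a x + 1 := by
  simp only [pkf]; omega

lemma pkf_mono (a : W) : Monotone (pkf a) := by
  apply monotone_nat_of_le_succ
  intro x
  cases x with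
  | zero => simp [pkf]
  | succ x =>
    have h1 := pkf_le_cnt a x
    have h2 := cntLe_mono a (show x ≤ x+1 by omega)
    have : pkf a (x+1+1) = min (pkf a (x+1)) (cntLe a (x+1)) + 1 := rfl
    omega

lemma cntLe_lt (a : W) {x : ℕ} (hx : x + 1 ∈ a) : cntLe a x < cntLe a (x+1) := by
  unfold cntLe
  induction a with
  | nil => simp at hx
  | cons y t ih =>
    have hm := cntLe_mono t (show x ≤ x+1 by omega)
    unfold cntLe at hm
    simp only [List.filter_cons]
    rcases List.mem_cons.1 hx with h | h
    · subst h
      simp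
      omega
    · have := ih h
      by_cases h1 : y ≤ x
      · have h2 : y ≤ x + 1 := by omega
        simp [h1, h2, this]
      · simp only [h1]
        split_ifs <;> simp_all <;> omega

lemma pkf_strict (a : W) (hp : ∀ x ∈ a, 1 ≤ x) : StrictMonoOn (pkf a) {x | x ∈ a} := by
  intro x hx y hy hxy
  have := hp x hx
  obtain ⟨x, rfl⟩ : ∃ z, x = z + 1 := ⟨x - 1, by omega⟩
  obtain ⟨y, rfl⟩ : ∃ z, y = z + 1 := ⟨y - 1, by omega⟩
  have h1 := pkf_le_cnt a x
  have h2 := cntLe_lt a hx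
  have h3 := cntLe_mono a (show x+1 ≤ y by omega)
  have h4 := pkf_mono a (show x+1 ≤ y by omega)
  have : pkf a (y+1) = min (pkf a y) (cntLe a y) + 1 := rfl
  omega

lemma dVal_spec (a : W) : cntLe a (dVal a) < dVal a :=
  Nat.find_spec (p := fun i => (a.filter (fun x => x ≤ i)).length < i)
    ⟨a.length + 1, Nat.lt_succ_of_le (List.length_filter_le _ _)⟩

lemma dVal_min (a : W) (i : ℕ) (h : i < dVal a) : i ≤ cntLe a i :=
  not_lt.1 (Nat.find_min (p := fun i => (a.filter (fun x => x ≤ i)).length < i)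
    ⟨a.length + 1, Nat.lt_succ_of_le (List.length_filter_le _ _)⟩ h)

lemma dVal_le (a : W) : dVal a ≤ a.length + 1 :=
  Nat.find_min' (p := fun i => (a.filter (fun x => x ≤ i)).length < i)
    ⟨a.length + 1, Nat.lt_succ_of_le (List.length_filter_le _ _)⟩
    (Nat.lt_succ_of_le (List.length_filter_le _ _))

lemma mem_le_of_cnt (a : W) (k : ℕ) (h : a.length ≤ cntLe a k) : ∀ x ∈ a, x ≤ k := by
  intro x hx
  have h1 : (a.filter (fun x => x ≤ k)) = a :=
    List.filter_sublist.eq_of_length_le h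
  rw [← h1] at hx
  simpa using (List.mem_filter.1 hx).2

lemma cnt_parkStep_lt (a : W) (k : ℕ) (h : k < dVal a) : cntLe (parkStep a) k = cntLe a k := by
  unfold cntLe
  rw [← List.countP_eq_length_filter, ← List.countP_eq_length_filter]
  unfold parkStep
  rw [List.countP_map]
  apply List.countP_congr
  intro x hx
  simp
  split_ifs <;> omega

lemma cnt_parkStep_ge (a : W) (k : ℕ) (h : dVal a ≤ k) :
    cntLe (parkStep a) k = cntLe a (k+1) := by
  unfold cntLe
  rw [← List.countP_eq_length_filter, ← List.countP_eq_length_filter]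
  unfold parkStep
  rw [List.countP_map]
  apply List.countP_congr
  intro x hx
  simp
  split_ifs <;> omega

lemma dVal_pos (a : W) : 1 ≤ dVal a := by
  have := dVal_spec a
  omega

lemma pkf_parkStep_ge (a : W) : ∀ x, dVal a ≤ x → pkf (parkStep a) x = pkf a (x+1) := by
  intro x hx
  induction x, hx using Nat.le_induction with
  | base =>
    have h1 := pkf_eq_self a (dVal a) (dVal_min a) (dVal a) le_rfl
    have h2 := pkf_eq_self (parkStep a) (dVal a)
      (fun i hi => by rw [cnt_parkStep_lt a i hi]; exact dVal_min a i hi) (dVal a) le_rfl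
    have h3 := dVal_spec a
    have h4 := dVal_pos a
    have h5 := dVal_min a (dVal a - 1) (by omega)
    have h6 := cntLe_mono a (show dVal a - 1 ≤ dVal a by omega)
    simp only [pkf]
    omega
  | succ x hx ih =>
    have : pkf (parkStep a) (x+1) = min (pkf (parkStep a) x) (cntLe (parkStep a) x) + 1 := rfl
    rw [this, ih, cnt_parkStep_ge a x hx]
    rfl

lemma parkStep_pos (a : W) (hp : ∀ x ∈ a, 1 ≤ x) : ∀ x ∈ parkStep a, 1 ≤ x := by
  intro x hx
  unfold parkStep at hx
  obtain ⟨y, hy, rfl⟩ := List.mem_map.1 hx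
  have := hp y hy
  have := dVal_pos a
  split_ifs <;> omega

lemma sum_map_le_aux (f : ℕ → ℕ) (hf : ∀ x, f x ≤ x) (l : W) : (l.map f).sum ≤ l.sum := by
  induction l with
  | nil => simp
  | cons y t ih => have := hf y; simp; omega

lemma sum_map_lt_aux (f : ℕ → ℕ) (hf : ∀ x, f x ≤ x) (l : W) (h : ∃ x ∈ l, f x < x) :
    (l.map f).sum < l.sum := by
  induction l with
  | nil => simp at h
  | cons y t ih =>
    obtain ⟨x, hx, hlt⟩ := h
    have h1 := hf y
    have h2 := sum_map_le_aux f hf t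
    rcases List.mem_cons.1 hx with rfl | hx
    · simp; omega
    · have := ih ⟨x, hx, hlt⟩
      simp; omega

lemma parkStep_sum (a : W) (h : dVal a ≠ a.length + 1) : (parkStep a).sum < a.sum := by
  unfold parkStep
  apply sum_map_lt_aux
  · intro x; split_ifs <;> omega
  · by_contra hc
    push Not at hc
    have h1 : ∀ x ∈ a, x ≤ dVal a := by
      intro x hx
      have := hc x hx
      split_ifs at this <;> omega
    have h2 : cntLe a (dVal a) = a.length := by
      unfold cntLe
      rw [List.filter_eq_self.2]
      simpa using h1
    have := dVal_spec a
    have := dVal_le a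
    omega

lemma parkFuel_eq : ∀ (k : ℕ) (a : W), (∀ x ∈ a, 1 ≤ x) → a.sum ≤ k →
    parkFuel k a = a.map (pkf a) := by
  intro k
  induction k with
  | zero =>
    intro a hp hs
    cases a with
    | nil => rfl
    | cons y t => have := hp y (by simp); simp at hs; omega
  | succ k ih =>
    intro a hp hs
    unfold parkFuel
    split_ifs with h
    · symm
      have h1 : ∀ x ∈ a, x ≤ a.length :=
        mem_le_of_cnt a _ (dVal_min a _ (by omega))
      conv_rhs => rw [← List.map_id a]
      apply List.map_congr_left
      intro x hx
      have := h1 x hx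
      exact pkf_eq_self a (dVal a) (dVal_min a) x (by omega)
    · have := parkStep_sum a h
      rw [ih _ (parkStep_pos a hp) (by omega)]
      conv_lhs => arg 2; unfold parkStep
      rw [List.map_map]
      apply List.map_congr_left
      intro x hx
      simp only [Function.comp]
      split_ifs with hd
      · rw [pkf_parkStep_ge a _ (by omega)]
        congr 1
        omega
      · rw [pkf_eq_self a (dVal a) (dVal_min a) x (by omega)]
        exact pkf_eq_self (parkStep a) (dVal a)
          (fun i hi => by rw [cnt_parkStep_lt a i hi]; exact dVal_min a i hi) x (by omega)

lemma Park_eq (a : W) (hp : ∀ x ∈ a, 1 ≤ x) : Park a = a.map (pkf a) :=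
  parkFuel_eq _ a hp le_rfl

/- segments -/

lemma segs_cons (x : ℕ) (xs : W) : segs (x :: xs) =
    (x :: xs.takeWhile fun y => x ≤ y) :: segs (xs.dropWhile fun y => x ≤ y) := by
  rw [segs]

lemma segs_flatten (a : W) : (segs a).flatten = a := by
  induction a using segs.induct with
  | case1 => simp [segs]
  | case2 x xs ih => rw [segs_cons]; simp [ih, List.takeWhile_append_dropWhile]

lemma segs_ne_nil (a : W) : ∀ w ∈ segs a, w ≠ [] := by
  induction a using segs.induct with
  | case1 => simp [segs]
  | case2 x xs ih => rw [segs_cons]; simpa using ih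

lemma segs_head (a : W) : ∀ w ∈ segs a, w.headD 0 ≤ a.headD 0 := by
  induction a using segs.induct with
  | case1 => simp [segs]
  | case2 x xs ih =>
    rw [segs_cons]
    intro w hw
    rcases List.mem_cons.1 hw with rfl | hw
    · simp
    · have h1 := ih w hw
      cases h : xs.dropWhile (fun y => decide (x ≤ y)) with
      | nil => rw [h] at hw; simp [segs] at hw
      | cons y t =>
        have := List.head_dropWhile_not (p := (fun y => decide (x ≤ y))) (l := xs) (by simp [h])
        simp [h] at this h1 ⊢
        omega

lemma segs_pairwise (a : W) : (segs a).Pairwise (fun u v => v.headD 0 < u.headD 0) := by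
  induction a using segs.induct with
  | case1 => simp [segs]
  | case2 x xs ih =>
    rw [segs_cons]
    refine List.Pairwise.cons ?_ ih
    intro w hw
    have h1 := segs_head _ w hw
    cases h : xs.dropWhile (fun y => decide (x ≤ y)) with
    | nil => rw [h] at hw; simp [segs] at hw
    | cons y t =>
      have := List.head_dropWhile_not (p := (fun y => decide (x ≤ y))) (l := xs) (by simp [h])
      simp [h] at this h1 ⊢
      omega

lemma segs_nodup (a : W) : (segs a).Nodup :=
  (segs_pairwise a).imp (fun h e => by subst e; omega)

lemma LR_nodup (a : W) : (LR a).Nodup := List.nodup_reverse.2 (segs_nodup a)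

lemma mem_LR_ne (a w : W) (h : w ∈ LR a) : w ≠ [] := segs_ne_nil a w (by simpa [LR] using h)

lemma mem_of_mem_LR {a w : W} (h : w ∈ LR a) {x : ℕ} (hx : x ∈ w) : x ∈ a := by
  rw [← segs_flatten a]
  exact List.mem_flatten.2 ⟨w, by simpa [LR] using h, hx⟩

lemma exists_LR_of_mem {a : W} {x : ℕ} (hx : x ∈ a) : ∃ w ∈ LR a, x ∈ w := by
  rw [← segs_flatten a] at hx
  obtain ⟨w, hw, h⟩ := List.mem_flatten.1 hx
  exact ⟨w, by simpa [LR] using hw, h⟩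

lemma segs_map (f : ℕ → ℕ) (a : W) (hf : StrictMonoOn f {x | x ∈ a}) :
    segs (a.map f) = (segs a).map (List.map f) := by
  induction a using segs.induct with
  | case1 => simp [segs]
  | case2 x xs ih =>
    have key : ∀ y ∈ xs, decide (f x ≤ f y) = decide (x ≤ y) := by
      intro y hy
      rw [decide_eq_decide]
      exact hf.le_iff_le (by simp) (by simp [hy])
    have h1 : (xs.map f).takeWhile (fun y => decide (f x ≤ y)) =
        (xs.takeWhile (fun y => decide (x ≤ y))).map f := by
      clear ih hf
      induction xs with
      | nil => simp
      | cons y t ih =>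
        have := key y (by simp)
        have := ih (fun z hz => key z (by simp [hz]))
        simp only [List.map_cons, List.takeWhile_cons]
        split <;> simp_all
    have h2 : (xs.map f).dropWhile (fun y => decide (f x ≤ y)) =
        (xs.dropWhile (fun y => decide (x ≤ y))).map f := by
      clear ih hf h1
      induction xs with
      | nil => simp
      | cons y t ih =>
        have h3 := key y (by simp)
        have h4 := ih (fun z hz => key z (by simp [hz]))
        simp only [List.map_cons, List.dropWhile_cons, h3, h4]
        split <;> simp
    rw [List.map_cons, segs_cons, segs_cons, h1, h2, ih]
    · simp
    · apply hf.mono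
      intro y hy
      exact List.mem_cons_of_mem _ ((List.dropWhile_sublist _).subset hy)

lemma LR_map (f : ℕ → ℕ) (a : W) (hf : StrictMonoOn f {x | x ∈ a}) :
    LR (a.map f) = (LR a).map (List.map f) := by
  unfold LR
  rw [segs_map f a hf, List.map_reverse]

lemma lex_map (f : ℕ → ℕ) (S : Set ℕ) (hf : StrictMonoOn f S) : ∀ u v : W,
    (∀ x ∈ u, x ∈ S) → (∀ x ∈ v, x ∈ S) → u < v → u.map f < v.map f := by
  intro u
  induction u with
  | nil =>
    intro v _ _ h
    cases v with
    | nil => simp at h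
    | cons y t => simp
  | cons x u ih =>
    intro v hu hv h
    cases v with
    | nil => simp at h
    | cons y t =>
      simp only [List.map_cons]
      rw [List.cons_lt_cons_iff] at h ⊢
      rcases h with h | ⟨rfl, h⟩
      · exact Or.inl (hf (hu x (by simp)) (hv y (by simp)) h)
      · exact Or.inr ⟨rfl, ih t (fun z hz => hu z (by simp [hz])) (fun z hz => hv z (by simp [hz])) h⟩

lemma wordOfSet_image (f : ℕ → ℕ) (S : Set ℕ) (hf : StrictMonoOn f S) (G : Finset W)
    (hG : ∀ w ∈ G, ∀ x ∈ w, x ∈ S) :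
    wordOfSet (G.image (List.map f)) = (wordOfSet G).map f := by
  unfold wordOfSet
  have h : StrictMonoOn (List.map f) (G : Set W) := by
    intro u hu v hv huv
    exact lex_map f S hf u v (hG u hu) (hG v hv) huv
  have h2 : ((G.sort (· ≤ ·)).map (List.map f)).toFinset = G.image (List.map f) := by
    ext w; simp
  have h3 : ((G.sort (· ≤ ·)).map (List.map f)).Nodup :=
    (Finset.sort_nodup G _).map_on (fun u hu v hv e =>
      h.injOn ((Finset.mem_sort _).1 hu) ((Finset.mem_sort _).1 hv) e)
  have h4 : ((G.sort (· ≤ ·)).map (List.map f)).Pairwise (· ≤ ·) := by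
    rw [List.pairwise_map]
    apply (Finset.pairwise_sort G (· ≤ ·)).imp_of_mem
    intro u v hu hv huv
    exact h.monotoneOn ((Finset.mem_sort _).1 hu) ((Finset.mem_sort _).1 hv) huv
  rw [← h2, (List.toFinset_sort _ h3).2 h4, List.map_flatten, List.map_reverse]

lemma cntLe_flatten (L : List W) (k : ℕ) : cntLe L.flatten k = (L.map (cntLe · k)).sum := by
  induction L with
  | nil => rfl
  | cons w t ih => rw [List.map_cons, List.sum_cons, ← ih]; simp only [cntLe, List.flatten_cons, List.filter_append, List.length_append]

lemma cntLe_wordOfSet (G : Finset W) (k : ℕ) :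
    cntLe (wordOfSet G) k = ∑ w ∈ G, cntLe w k := by
  unfold wordOfSet
  rw [cntLe_flatten, List.map_reverse, List.sum_reverse, ← List.sum_toFinset _ (Finset.sort_nodup _ _),
    Finset.sort_toFinset]

lemma cntLe_LR (a : W) (k : ℕ) : cntLe a k = ∑ w ∈ (LR a).toFinset, cntLe w k := by
  conv_lhs => rw [← segs_flatten a]
  rw [cntLe_flatten, List.sum_toFinset _ (LR_nodup a), LR, List.map_reverse, List.sum_reverse]

lemma length_LR (a : W) : a.length = ∑ w ∈ (LR a).toFinset, w.length := by
  conv_lhs => rw [← segs_flatten a]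
  rw [List.length_flatten, List.sum_toFinset _ (LR_nodup a), LR, List.map_reverse, List.sum_reverse]

lemma mem_wordOfSet (G : Finset W) (x : ℕ) : x ∈ wordOfSet G ↔ ∃ w ∈ G, x ∈ w := by
  unfold wordOfSet
  simp

lemma PF_cnt (a : W) (ha : IsPF a) (k : ℕ) (hk : k ≤ a.length) : k ≤ cntLe a k := by
  set s := a.insertionSort (· ≤ ·) with hs
  have hperm : s.Perm a := List.perm_insertionSort _ _
  have hlen : s.length = a.length := hperm.length_eq
  have h1 : cntLe a k = cntLe s k := ((hperm.filter _).length_eq).symm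
  rw [h1]
  have h2 : cntLe (s.take k) k ≤ cntLe s k := ((List.take_sublist k s).filter _).length_le
  have h3 : cntLe (s.take k) k = k := by
    unfold cntLe
    rw [List.filter_eq_self.2]
    · simp; omega
    · intro x hx
      obtain ⟨i, hi, rfl⟩ := List.getElem_of_mem hx
      simp at hi ⊢
      have := ha.2 i (by omega)
      rw [← hs, List.getD_eq_getElem _ _ (by omega)] at this
      omega
  omega

lemma sub_bound (a a' : W) (ha : IsPF a) (h : (LR a').toFinset ⊆ (LR a).toFinset) (k : ℕ)
    (hk : k ≤ a.length) : a'.length + k ≤ cntLe a' k + a.length := by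
  have h1 := PF_cnt a ha k hk
  have h2 : ∀ w : W, cntLe w k ≤ w.length := fun w => List.length_filter_le _ _
  rw [length_LR a', cntLe_LR a' k]
  rw [length_LR a] at *
  rw [cntLe_LR a k] at h1
  rw [← Finset.sum_sdiff h] at h1
  rw [← Finset.sum_sdiff h (f := fun w => w.length)]
  have h3 := Finset.sum_le_sum (fun w (_ : w ∈ (LR a).toFinset \ (LR a').toFinset) => h2 w)
  omega
lemma glue_sum (X Y : Finset W) (T : Finset (W × W)) (m : ℕ)
    (hX : ∀ u ∈ X, u ≠ [] ∧ ∀ x ∈ u, x ≤ m) (hY : ∀ u ∈ Y, u ≠ [] ∧ ∀ x ∈ u, m < x)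
    (hT : ∀ p ∈ T, p.1 ∈ X ∧ p.2 ∈ Y)
    (hi : ∀ p ∈ T, ∀ q ∈ T, (p.1 = q.1 ∨ p.2 = q.2) → p = q)
    (hu : ∀ u ∈ X, ∀ w ∈ Y, ∀ p ∈ T, p.1 ++ p.2 = u ++ w → p = (u, w))
    (F : W → ℕ) (hF : ∀ u v, F (u ++ v) = F u + F v) :
    ∑ w ∈ glueSet X Y T, F w = ∑ w ∈ X, F w + ∑ w ∈ Y, F w := by
  unfold glueSet
  have head_mem : ∀ u : W, u ≠ [] → ∃ x, x ∈ u := fun u h => List.exists_mem_of_ne_nil u h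
  rw [Finset.sum_union, Finset.sum_union, Finset.sum_image]
  · simp only [hF]
    rw [Finset.sum_add_distrib]
    have e1 : X.filter (fun u => ¬ ∀ p ∈ T, p.1 ≠ u) = T.image Prod.fst := by
      ext u
      simp only [Finset.mem_filter, Finset.mem_image]
      push Not
      constructor
      · rintro ⟨_, p, hp, rfl⟩; exact ⟨p, hp, rfl⟩
      · rintro ⟨p, hp, rfl⟩; exact ⟨(hT p hp).1, p, hp, rfl⟩
    have e2 : Y.filter (fun u => ¬ ∀ p ∈ T, p.2 ≠ u) = T.image Prod.snd := by
      ext u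
      simp only [Finset.mem_filter, Finset.mem_image]
      push Not
      constructor
      · rintro ⟨_, p, hp, rfl⟩; exact ⟨p, hp, rfl⟩
      · rintro ⟨p, hp, rfl⟩; exact ⟨(hT p hp).2, p, hp, rfl⟩
    rw [← Finset.sum_filter_add_sum_filter_not X (fun u => ∀ p ∈ T, p.1 ≠ u),
      ← Finset.sum_filter_add_sum_filter_not Y (fun u => ∀ p ∈ T, p.2 ≠ u), e1, e2,
      Finset.sum_image (fun p hp q hq h => hi p hp q hq (Or.inl h)),
      Finset.sum_image (fun p hp q hq h => hi p hp q hq (Or.inr h))]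
    omega
  · intro p hp q hq h
    have hq' := hT q hq
    exact hu q.1 hq'.1 q.2 hq'.2 p hp h
  · rw [Finset.disjoint_left]
    rintro w hw hw2
    obtain ⟨p, hp, rfl⟩ := Finset.mem_image.1 hw
    have h1 := (Finset.mem_filter.1 hw2).1
    obtain ⟨x, hx⟩ := head_mem _ (hY _ (hT p hp).2).1
    have := (hY _ (hT p hp).2).2 x hx
    have := (hX _ h1).2 x (by simp [hx])
    omega
  · rw [Finset.disjoint_left]
    rintro w hw hw2
    have h1 := (Finset.mem_filter.1 hw2).1
    rcases Finset.mem_union.1 hw with hw | hw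
    · obtain ⟨p, hp, rfl⟩ := Finset.mem_image.1 hw
      obtain ⟨x, hx⟩ := head_mem _ (hX _ (hT p hp).1).1
      have := (hX _ (hT p hp).1).2 x hx
      have := (hY _ h1).2 x (by simp [hx])
      omega
    · have h2 := (Finset.mem_filter.1 hw).1
      obtain ⟨x, hx⟩ := head_mem _ (hX _ h2).1
      have := (hX _ h2).2 x hx
      have := (hY _ h1).2 x hx
      omega

lemma append_unique (m : ℕ) : ∀ (u u' v v' : W), (∀ x ∈ u, x ≤ m) → (∀ x ∈ u', x ≤ m) →
    (∀ x ∈ v, m < x) → (∀ x ∈ v', m < x) → u ++ v = u' ++ v' → u = u' ∧ v = v' := by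
  intro u
  induction u with
  | nil =>
    intro u' v v' _ h2 h3 _ h
    cases u' with
    | nil => simpa using h
    | cons y t =>
      have := h2 y (by simp)
      have := h3 y (by simp at h; simp [h])
      omega
  | cons z s ih =>
    intro u' v v' h1 h2 h3 h4 h
    cases u' with
    | nil =>
      have := h1 z (by simp)
      have := h4 z (by simp at h; simp [← h])
      omega
    | cons y t =>
      simp at h
      obtain ⟨rfl, h⟩ := h
      have := ih t v v' (fun x hx => h1 x (by simp [hx])) (fun x hx => h2 x (by simp [hx])) h3 h4 h
      simp [this]

lemma glue_image (X Y : Finset W) (T : Finset (W × W)) (g : W → W)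
    (hT : ∀ p ∈ T, p.1 ∈ X ∧ p.2 ∈ Y)
    (hg : ∀ u v, g (u ++ v) = g u ++ g v) (hX : Set.InjOn g X) (hY : Set.InjOn g Y) :
    (glueSet X Y T).image g =
      glueSet (X.image g) (Y.image g) (T.image (fun p => (g p.1, g p.2))) := by
  unfold glueSet
  rw [Finset.image_union, Finset.image_union]
  congr 1
  · congr 1
    · rw [Finset.image_image, Finset.image_image]
      apply Finset.image_congr
      intro p _
      simp [hg]
    · ext w
      simp only [Finset.mem_image, Finset.mem_filter]
      constructor
      · rintro ⟨u, ⟨hu, h⟩, rfl⟩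
        refine ⟨⟨u, hu, rfl⟩, ?_⟩
        rintro _ ⟨p, hp, rfl⟩ e
        exact h p hp (hX (hT p hp).1 hu e)
      · rintro ⟨⟨u, hu, rfl⟩, h⟩
        refine ⟨u, ⟨hu, ?_⟩, rfl⟩
        rintro p hp rfl
        exact h _ ⟨p, hp, rfl⟩ rfl
  · ext w
    simp only [Finset.mem_image, Finset.mem_filter]
    constructor
    · rintro ⟨u, ⟨hu, h⟩, rfl⟩
      refine ⟨⟨u, hu, rfl⟩, ?_⟩
      rintro _ ⟨p, hp, rfl⟩ e
      exact h p hp (hY (hT p hp).2 hu e)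
    · rintro ⟨⟨u, hu, rfl⟩, h⟩
      refine ⟨u, ⟨hu, ?_⟩, rfl⟩
      rintro p hp rfl
      exact h _ ⟨p, hp, rfl⟩ rfl

lemma map_injOn (f : ℕ → ℕ) (S : Set ℕ) (hf : Set.InjOn f S) : ∀ u v : W, (∀ x ∈ u, x ∈ S) →
    (∀ x ∈ v, x ∈ S) → u.map f = v.map f → u = v := by
  intro u
  induction u with
  | nil => intro v _ _ h; simpa using h.symm
  | cons x t ih =>
    intro v hu hv h
    cases v with
    | nil => simp at h
    | cons y s =>
      simp at h
      rw [hf (hu x (by simp)) (hv y (by simp)) h.1,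
        ih s (fun z hz => hu z (by simp [hz])) (fun z hz => hv z (by simp [hz])) h.2]

lemma cntLe_shift (m j : ℕ) (w : W) : cntLe (shiftW m w) (m + j) = cntLe w j := by
  unfold cntLe shiftW
  rw [← List.countP_eq_length_filter, ← List.countP_eq_length_filter, List.countP_map]
  apply List.countP_congr
  intro x _
  simp
  omega

lemma cntLe_zero_of (w : W) (m k : ℕ) (hk : k ≤ m) (h : ∀ x ∈ w, m < x) : cntLe w k = 0 := by
  unfold cntLe
  rw [List.filter_eq_nil_iff.2]
  · rfl
  · intro x hx
    have := h x hx
    simp; omega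

lemma shiftW_inj (m : ℕ) : Function.Injective (shiftW m) :=
  List.map_injective_iff.2 (fun x y h => by simpa using h)

lemma shiftF_toFinset (m : ℕ) (L : List W) :
    (shiftF m L).toFinset = L.toFinset.image (shiftW m) := by
  ext w; simp [shiftF]

lemma mem_LR_iff_getD (L : List W) (u : W) : u ∈ L ↔ ∃ i < L.length, L.getD i [] = u := by
  rw [List.mem_iff_getElem]
  constructor
  · rintro ⟨i, hi, rfl⟩; exact ⟨i, hi, List.getD_eq_getElem _ _ hi⟩
  · rintro ⟨i, hi, rfl⟩; exact ⟨i, hi, (List.getD_eq_getElem _ _ hi).symm⟩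

lemma getD_map_nil (L : List W) (i : ℕ) (g : W → W) (hg : g [] = []) :
    (L.map g).getD i [] = g (L.getD i []) := by
  simp only [List.getD_eq_getElem?_getD, List.getElem?_map]
  cases L[i]? <;> simp [hg]

/-- Lemma 3.4 of the paper:
`Park (a' Θ_m b') = Park(a') Θ' Park(b')`. -/
theorem stmt4 (a b a' b' : W) (ha : IsPF a) (hb : IsPF b)
    (Θ : Finset (W × W)) (hΘ : Θ ∈ Rset a b)
    (ha' : (LR a').toFinset ⊆ (LR a).toFinset)
    (hb' : (LR b').toFinset ⊆ (LR b).toFinset) :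
    Park (glueSub a a' b' Θ) =
      wordOfSet (glueSet (LR (Park a')).toFinset
        (shiftF a'.length (LR (Park b'))).toFinset (thetaPrime a a' b' Θ)) := by
  -- basic facts on letters
  have hale : ∀ x ∈ a, x ≤ a.length := mem_le_of_cnt a _ (PF_cnt a ha _ le_rfl)
  have hsubA : ∀ x ∈ a', x ∈ a := by
    intro x hx
    obtain ⟨w, hw, hxw⟩ := exists_LR_of_mem hx
    exact mem_of_mem_LR (List.mem_toFinset.1 (ha' (List.mem_toFinset.2 hw))) hxw
  have hsubB : ∀ x ∈ b', x ∈ b := by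
    intro x hx
    obtain ⟨w, hw, hxw⟩ := exists_LR_of_mem hx
    exact mem_of_mem_LR (List.mem_toFinset.1 (hb' (List.mem_toFinset.2 hw))) hxw
  have hpa : ∀ x ∈ a', 1 ≤ x := fun x hx => ha.1 x (hsubA x hx)
  have hpb : ∀ x ∈ b', 1 ≤ x := fun x hx => hb.1 x (hsubB x hx)
  have hla : ∀ x ∈ a', x ≤ a.length := fun x hx => hale x (hsubA x hx)
  have hbound := sub_bound a a' ha ha'
  have hi0 : ∀ p ∈ Θ, ∀ q ∈ Θ, (p.1 = q.1 ∨ p.2 = q.2) → p = q := (Finset.mem_filter.1 hΘ).2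
  unfold glueSub thetaPrime
  obtain ⟨m, hm⟩ : ∃ m, m = a.length := ⟨_, rfl⟩
  rw [← hm] at hbound hla ⊢
  obtain ⟨T, hTdef⟩ : ∃ T, T = restrictTheta a a' b' Θ := ⟨_, rfl⟩
  rw [← hTdef]
  obtain ⟨X, hXdef⟩ : ∃ X, X = (LR a').toFinset := ⟨_, rfl⟩
  obtain ⟨Y, hYdef⟩ : ∃ Y, Y = (shiftF m (LR b')).toFinset := ⟨_, rfl⟩
  have hT : ∀ p ∈ T, p.1 ∈ X ∧ p.2 ∈ Y := by
    intro p hp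
    rw [hTdef, restrictTheta, Finset.mem_filter, ← hm] at hp
    rw [hXdef, hYdef]
    exact hp.2
  have hi : ∀ p ∈ T, ∀ q ∈ T, (p.1 = q.1 ∨ p.2 = q.2) → p = q := by
    intro p hp q hq
    rw [hTdef, restrictTheta] at hp hq
    exact hi0 p (Finset.mem_filter.1 hp).1 q (Finset.mem_filter.1 hq).1
  rw [← hXdef, ← hYdef]
  have hX : ∀ u ∈ X, u ≠ [] ∧ ∀ x ∈ u, x ∈ a' := by
    intro u hu
    rw [hXdef, List.mem_toFinset] at hu
    exact ⟨mem_LR_ne _ _ hu, fun x hx => mem_of_mem_LR hu hx⟩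
  have hY : ∀ u ∈ Y, u ≠ [] ∧ ∀ x ∈ u, ∃ y ∈ b', x = m + y := by
    intro u hu
    rw [hYdef, shiftF_toFinset, Finset.mem_image] at hu
    obtain ⟨w, hw, rfl⟩ := hu
    rw [List.mem_toFinset] at hw
    refine ⟨by simpa [shiftW] using mem_LR_ne _ _ hw, ?_⟩
    intro x hx
    obtain ⟨y, hy, rfl⟩ := List.mem_map.1 hx
    exact ⟨y, mem_of_mem_LR hw hy, by omega⟩
  have hX' : ∀ u ∈ X, u ≠ [] ∧ ∀ x ∈ u, x ≤ m :=
    fun u hu => ⟨(hX u hu).1, fun x hx => hla x ((hX u hu).2 x hx)⟩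
  have hY' : ∀ u ∈ Y, u ≠ [] ∧ ∀ x ∈ u, m < x := by
    refine fun u hu => ⟨(hY u hu).1, fun x hx => ?_⟩
    obtain ⟨y, hy, rfl⟩ := (hY u hu).2 x hx
    have := hpb y hy
    omega
  have hu : ∀ u ∈ X, ∀ w ∈ Y, ∀ p ∈ T, p.1 ++ p.2 = u ++ w → p = (u, w) := by
    intro u hu w hw p hp h
    have := append_unique m p.1 u p.2 w (hX' _ (hT p hp).1).2 (hX' _ hu).2
      (hY' _ (hT p hp).2).2 (hY' _ hw).2 h
    exact Prod.ext this.1 this.2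
  obtain ⟨c, hc⟩ : ∃ c, c = wordOfSet (glueSet X Y T) := ⟨_, rfl⟩
  rw [← hc]
  have hGmem : ∀ w ∈ glueSet X Y T, ∀ x ∈ w, x ∈ a' ∨ ∃ y ∈ b', x = m + y := by
    intro w hw x hx
    simp only [glueSet, Finset.mem_union, Finset.mem_image, Finset.mem_filter] at hw
    rcases hw with (⟨p, hp, rfl⟩ | hw) | hw
    · rcases List.mem_append.1 hx with h | h
      · exact Or.inl ((hX _ (hT p hp).1).2 x h)
      · exact Or.inr ((hY _ (hT p hp).2).2 x h)
    · exact Or.inl ((hX _ hw.1).2 x hx)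
    · exact Or.inr ((hY _ hw.1).2 x hx)
  have hcnt : ∀ k, cntLe c k = cntLe a' k + ∑ w ∈ Y, cntLe w k := by
    intro k
    rw [hc, cntLe_wordOfSet, glue_sum X Y T m hX' hY' hT hi hu, cntLe_LR a' k, hXdef]
    intro u v
    simp [cntLe]
  have hcnt1 : ∀ k ≤ m, cntLe c k = cntLe a' k := by
    intro k hk
    rw [hcnt, Finset.sum_eq_zero]
    · simp
    · intro w hw
      exact cntLe_zero_of w m k hk (hY' w hw).2
  have hcnt2 : ∀ j, cntLe c (m + j) = a'.length + cntLe b' j := by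
    intro j
    rw [hcnt]
    congr 1
    · unfold cntLe
      rw [List.filter_eq_self.2]
      intro x hx
      have := hla x hx
      simp; omega
    · rw [hYdef, shiftF_toFinset, Finset.sum_image (fun u _ v _ h => shiftW_inj m h), cntLe_LR b' j]
      exact Finset.sum_congr rfl (fun w _ => cntLe_shift m j w)
  have hf1 : ∀ x ≤ m, pkf c x = pkf a' x := by
    intro x
    induction x with
    | zero => intro _; rfl
    | succ x ih =>
      intro hx
      simp only [pkf]
      rw [ih (by omega), hcnt1 x (by omega)]
  have hge : ∀ x ≤ m, a'.length + x ≤ pkf c x + m := by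
    intro x
    induction x with
    | zero =>
      intro _
      have h1 := hbound 0 (by omega)
      have : cntLe a' 0 = 0 := cntLe_zero_of a' 0 0 le_rfl (fun x hx => hpa x hx)
      omega
    | succ x ih =>
      intro hx
      have h1 := ih (by omega)
      have h2 := hbound x (by omega)
      have h3 := hcnt1 x (by omega)
      simp only [pkf]
      omega
  have hf2 : ∀ y, pkf c (m + (y + 1)) = a'.length + pkf b' (y + 1) := by
    intro y
    induction y with
    | zero =>
      have h1 := hge m le_rfl
      have h2 := hcnt2 0
      have h3 : pkf c (m + (0 + 1)) = min (pkf c m) (cntLe c m) + 1 := rfl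
      have h4 : pkf b' (0 + 1) = min 0 (cntLe b' 0) + 1 := rfl
      have h5 : cntLe b' 0 = 0 := cntLe_zero_of b' 0 0 le_rfl (fun x hx => hpb x hx)
      simp only [Nat.add_zero] at h2
      omega
    | succ y ih =>
      have h2 := hcnt2 (y+1)
      have h3 : pkf c (m + (y + 1 + 1)) = min (pkf c (m + (y+1))) (cntLe c (m + (y+1))) + 1 := rfl
      have h4 : pkf b' (y + 1 + 1) = min (pkf b' (y+1)) (cntLe b' (y+1)) + 1 := rfl
      omega
  have hpc : ∀ x ∈ c, 1 ≤ x := by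
    intro x hx
    rw [hc, mem_wordOfSet] at hx
    obtain ⟨w, hw, hxw⟩ := hx
    rcases hGmem w hw x hxw with h | ⟨y, hy, rfl⟩
    · exact hpa x h
    · have := hpb y hy
      omega
  have hstrict := pkf_strict c hpc
  have hGc : ∀ w ∈ glueSet X Y T, ∀ x ∈ w, x ∈ {x | x ∈ c} := by
    intro w hw x hx
    show x ∈ c
    rw [hc, mem_wordOfSet]
    exact ⟨w, hw, hx⟩
  have hXc : ∀ u ∈ X, ∀ x ∈ u, x ∈ {x | x ∈ c} := by
    intro u hu' x hx
    by_cases h : ∃ p ∈ T, p.1 = u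
    · obtain ⟨p, hp, rfl⟩ := h
      refine hGc (p.1 ++ p.2) ?_ x (by simp [hx])
      simp only [glueSet, Finset.mem_union, Finset.mem_image, Finset.mem_filter]
      exact Or.inl (Or.inl ⟨p, hp, rfl⟩)
    · push Not at h
      refine hGc u ?_ x hx
      simp only [glueSet, Finset.mem_union, Finset.mem_image, Finset.mem_filter]
      exact Or.inl (Or.inr ⟨hu', h⟩)
  have hYc : ∀ u ∈ Y, ∀ x ∈ u, x ∈ {x | x ∈ c} := by
    intro u hu' x hx
    by_cases h : ∃ p ∈ T, p.2 = u
    · obtain ⟨p, hp, rfl⟩ := h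
      refine hGc (p.1 ++ p.2) ?_ x (by simp [hx])
      simp only [glueSet, Finset.mem_union, Finset.mem_image, Finset.mem_filter]
      exact Or.inl (Or.inl ⟨p, hp, rfl⟩)
    · push Not at h
      refine hGc u ?_ x hx
      simp only [glueSet, Finset.mem_union, Finset.mem_image, Finset.mem_filter]
      exact Or.inr ⟨hu', h⟩
  have hLa : LR (Park a') = (LR a').map (List.map (pkf c)) := by
    rw [Park_eq a' hpa, LR_map _ _ (pkf_strict a' hpa)]
    apply List.map_congr_left
    intro w hw
    apply List.map_congr_left
    intro x hx
    exact (hf1 x (hla x (mem_of_mem_LR hw hx))).symm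
  have hLb : shiftF a'.length (LR (Park b')) = (shiftF m (LR b')).map (List.map (pkf c)) := by
    rw [Park_eq b' hpb, LR_map _ _ (pkf_strict b' hpb)]
    unfold shiftF
    rw [List.map_map, List.map_map]
    apply List.map_congr_left
    intro w hw
    simp only [Function.comp, shiftW, List.map_map]
    apply List.map_congr_left
    intro x hx
    have := hpb x (mem_of_mem_LR hw hx)
    obtain ⟨y, rfl⟩ : ∃ z, x = z + 1 := ⟨x - 1, by omega⟩
    have := hf2 y
    simp only [Function.comp]
    rw [Nat.add_comm (y+1) m]
    omega
  -- the two sides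
  rw [Park_eq c hpc]
  have hw := wordOfSet_image (pkf c) {x | x ∈ c} hstrict (glueSet X Y T) hGc
  rw [← hc] at hw
  rw [← hw, glue_image X Y T (List.map (pkf c)) hT (fun u v => List.map_append)
    (fun u hu' v hv h => map_injOn _ _ hstrict.injOn u v (hXc u hu') (hXc v hv) h)
    (fun u hu' v hv h => map_injOn _ _ hstrict.injOn u v (hYc u hu') (hYc v hv) h)]
  have eX : (LR (Park a')).toFinset = X.image (List.map (pkf c)) := by
    rw [hLa, hXdef]; ext w; simp
  have eY : (shiftF a'.length (LR (Park b'))).toFinset = Y.image (List.map (pkf c)) := by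
    rw [hLb, hYdef]; ext w; simp
  rw [eX, eY]
  congr 2
  have gA : ∀ i, (LR (Park a')).getD i [] = ((LR a').getD i []).map (pkf c) := by
    intro i
    rw [hLa]
    exact getD_map_nil _ _ _ rfl
  have gS : ∀ (k : ℕ) (L : List W) i, (shiftF k L).getD i [] = shiftW k (L.getD i []) := by
    intro k L i
    exact getD_map_nil _ _ _ rfl
  have gB : ∀ i, shiftW a'.length ((LR (Park b')).getD i []) =
      (shiftW m ((LR b').getD i [])).map (pkf c) := by
    intro i
    rw [← gS, ← gS, hLb]
    exact getD_map_nil _ _ _ rfl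
  have hedge : ∀ u ∈ X, ∀ w ∈ Y, u ++ w ∈ glueSet X Y T ↔ (u, w) ∈ T := by
    intro u huX w hwY
    simp only [glueSet, Finset.mem_union, Finset.mem_image, Finset.mem_filter]
    constructor
    · rintro ((⟨p, hp, h⟩ | ⟨h, _⟩) | ⟨h, _⟩)
      · rw [← hu u huX w hwY p hp h]; exact hp
      · obtain ⟨x, hx⟩ := List.exists_mem_of_ne_nil w (hY' w hwY).1
        have := (hY' w hwY).2 x hx
        have := (hX' _ h).2 x (by simp [hx])
        omega
      · obtain ⟨x, hx⟩ := List.exists_mem_of_ne_nil u (hX' u huX).1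
        have := (hX' u huX).2 x hx
        have := (hY' _ h).2 x (by simp [hx])
        omega
    · intro h
      exact Or.inl (Or.inl ⟨_, h, rfl⟩)
  have hXi : ∀ u, u ∈ X ↔ ∃ i < (LR a').length, (LR a').getD i [] = u := by
    intro u; rw [hXdef, List.mem_toFinset, mem_LR_iff_getD]
  have hYi : ∀ w, w ∈ Y ↔ ∃ i < (LR b').length, shiftW m ((LR b').getD i []) = w := by
    intro u
    rw [hYdef, List.mem_toFinset, mem_LR_iff_getD]
    simp only [gS]
    simp [shiftF]
  ext q
  simp only [Finset.mem_image, Finset.mem_filter, Finset.mem_product, Finset.mem_range, gA, gB]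
  constructor
  · rintro ⟨p, hp, rfl⟩
    obtain ⟨i, hi1, hi2⟩ := (hXi _).1 (hT p hp).1
    obtain ⟨j, hj1, hj2⟩ := (hYi _).1 (hT p hp).2
    refine ⟨(i, j), ⟨⟨hi1, hj1⟩, ?_⟩, ?_⟩
    · simp only [hi2, hj2]
      exact (hedge _ (hT p hp).1 _ (hT p hp).2).2 hp
    · simp only [hi2, hj2]
  · rintro ⟨⟨i, j⟩, ⟨⟨hi1, hj1⟩, h⟩, rfl⟩
    exact ⟨_, (hedge _ ((hXi _).2 ⟨i, hi1, rfl⟩) _ ((hYi _).2 ⟨j, hj1, rfl⟩)).1 h, rfl⟩
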